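/- arXiv:2210.01631 — 3 statements merged into one kernel-verified Lean document; each statement's English description precedes it below -/
import Mathlib

section
/- Every compact Hausdorff admissible right topological (CHART) group with countable π-character is metrizable. -/
open Set Filter Topology

section BaireCategory

/-- If each row of a doubly indexed family of closed sets covers a Baire space, some point lies in
the interior of a member of every row. -/
theorem exists_forall_exists_mem_interior {X : Type*} [TopologicalSpace X] [BaireSpace X]
    [Nonempty X] (E : ℕ → ℕ → Set X) (hE : ∀ k m, IsClosed (E k m))
    (hU : ∀ k x, ∃ m, x ∈ E k m) : ∃ x, ∀ k, ∃ m, x ∈ interior (E k m) := by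
  have hd : Dense (⋂ k, ⋃ m, interior (E k m)) :=
    dense_iInter_of_isOpen (fun k => isOpen_iUnion fun m => isOpen_interior) fun k =>
      dense_iUnion_interior_of_closed (hE k)
        (eq_univ_of_forall fun x => mem_iUnion.2 (hU k x))
  obtain ⟨x, hx⟩ := hd.nonempty
  exact ⟨x, fun k => by simpa using mem_iInter.1 hx k⟩

/-- A pointwise limit of a sequence of continuous maps from a Baire space to a metric space has a
point of continuity. -/
theorem exists_continuousAt_of_tendsto {X Y : Type*} [TopologicalSpace X] [BaireSpace X]
    [Nonempty X] [PseudoMetricSpace Y] {u : ℕ → X → Y} {f : X → Y} (hu : ∀ n, Continuous (u n))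
    (hf : ∀ x, Tendsto (fun n => u n x) atTop (𝓝 (f x))) : ∃ x, ContinuousAt f x := by
  obtain ⟨x, hx⟩ := exists_forall_exists_mem_interior
    (fun k m => {x : X | ∀ n ≥ m, dist (u n x) (u m x) ≤ 1 / ((k : ℝ) + 1)})
    (fun k m => by
      simp only [ofPred_forall]
      exact isClosed_iInter fun n => isClosed_iInter fun _ =>
        isClosed_le ((hu n).dist (hu m)) continuous_const)
    (fun k x => by
      obtain ⟨N, hN⟩ := Metric.cauchySeq_iff'.1 (hf x).cauchySeq (1 / ((k : ℝ) + 1)) (by positivity)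
      exact ⟨N, fun n hn => (hN n hn).le⟩)
  refine ⟨x, Metric.tendsto_nhds.2 fun ε hε => ?_⟩
  obtain ⟨k, hk⟩ := exists_nat_one_div_lt (show (0 : ℝ) < ε / 3 by positivity)
  obtain ⟨m, hm⟩ := hx k
  have key : ∀ y ∈ {x : X | ∀ n ≥ m, dist (u n x) (u m x) ≤ 1 / ((k : ℝ) + 1)},
      dist (f y) (u m y) ≤ 1 / ((k : ℝ) + 1) := fun y hy =>
    le_of_tendsto ((hf y).dist tendsto_const_nhds) (eventually_atTop.2 ⟨m, hy⟩)
  filter_upwards [mem_interior_iff_mem_nhds.1 hm,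
    Metric.tendsto_nhds.1 (hu m).continuousAt (ε / 3) (by positivity)] with y hy hy'
  have h1 := key y hy
  have h2 := key x (interior_subset hm)
  have h3 := dist_triangle4 (f y) (u m y) (u m x) (f x)
  rw [dist_comm (u m x)] at h3
  linarith

end BaireCategory

/-- The subgroup generated by a countable set is countable. -/
theorem Subgroup.countable_closure {G : Type*} [Group G] {s : Set G} (hs : s.Countable) :
    Countable (Subgroup.closure s) := by
  have := hs.to_subtype
  rw [← Subtype.range_coe (s := s), ← FreeGroup.range_lift_eq_closure]
  exact (FreeGroup.lift ((↑) : s → G)).rangeRestrict_surjective.countable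

section RightTopologicalGroup

variable {G : Type*} [Group G] [TopologicalSpace G]

/-- In a metrizable CHART group all left translations are continuous. -/
theorem continuous_mul_left_of_metrizable [CompactSpace G] [TopologicalSpace.MetrizableSpace G]
    (hright : ∀ h : G, Continuous fun g : G => g * h)
    (hadm : Dense {g : G | Continuous fun h : G => g * h}) (g : G) :
    Continuous fun h : G => g * h := by
  let := TopologicalSpace.metrizableSpaceMetric G
  obtain ⟨u, hu, hug⟩ := mem_closure_iff_seq_limit.1 (hadm g)
  obtain ⟨x, hx⟩ := exists_continuousAt_of_tendsto hu
    fun y => ((hright y).tendsto g).comp hug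
  refine continuous_iff_continuousAt.2 fun y => ?_
  have h1 : Tendsto (fun h : G => h * (y⁻¹ * x)) (𝓝 y) (𝓝 x) := by
    simpa using (hright (y⁻¹ * x)).tendsto y
  have h2 := ((hright (x⁻¹ * y)).tendsto (g * x)).comp (hx.tendsto.comp h1)
  simpa [ContinuousAt, Function.comp_def, mul_assoc] using h2

/-- Multiplication of a metrizable CHART group is jointly continuous. -/
theorem continuousMul_of_metrizable [CompactSpace G] [TopologicalSpace.MetrizableSpace G]
    (hright : ∀ h : G, Continuous fun g : G => g * h)
    (hadm : Dense {g : G | Continuous fun h : G => g * h}) : ContinuousMul G := by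
  have hleft := continuous_mul_left_of_metrizable hright hadm
  let := TopologicalSpace.metrizableSpaceMetric G
  obtain ⟨a, ha⟩ := exists_forall_exists_mem_interior
    (fun k m => {x : G | ∀ y ∈ Metric.ball (1 : G) (1 / ((m : ℝ) + 1)),
      dist (x * y) x ≤ 1 / ((k : ℝ) + 1)})
    (fun k m => by
      simp only [ofPred_forall]
      exact isClosed_iInter fun y => isClosed_iInter fun _ =>
        isClosed_le ((hright y).dist continuous_id) continuous_const)
    (fun k x => by
      have h := (hleft x).tendsto 1
      rw [mul_one] at h
      obtain ⟨δ, hδ, h⟩ := Metric.eventually_nhds_iff_ball.1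
        (Metric.tendsto_nhds.1 h (1 / ((k : ℝ) + 1)) (by positivity))
      obtain ⟨m, hm⟩ := exists_nat_one_div_lt hδ
      exact ⟨m, fun y hy => (h y (Metric.ball_subset_ball hm.le hy)).le⟩)
  have hcont : Tendsto (fun p : G × G => p.1 * p.2) (𝓝 a ×ˢ 𝓝 1) (𝓝 a) := by
    refine Metric.tendsto_nhds.2 fun ε hε => ?_
    obtain ⟨k, hk⟩ := exists_nat_one_div_lt (show (0 : ℝ) < ε / 2 by positivity)
    obtain ⟨m, hm⟩ := ha k
    filter_upwards [prod_mem_prod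
      (inter_mem (mem_interior_iff_mem_nhds.1 hm)
        (Metric.ball_mem_nhds a (show (0 : ℝ) < ε / 2 by positivity)))
      (Metric.ball_mem_nhds (1 : G) (show (0 : ℝ) < 1 / ((m : ℝ) + 1) by positivity))]
      with p hp
    have h1 := hp.1.1 p.2 hp.2
    have h2 : dist p.1 a < ε / 2 := hp.1.2
    linarith [dist_triangle (p.1 * p.2) p.1 a]
  refine ⟨continuous_iff_continuousAt.2 fun ⟨g, h⟩ => ?_⟩
  have h1 : Tendsto (fun x : G => a * g⁻¹ * x) (𝓝 g) (𝓝 a) := by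
    simpa using (hleft (a * g⁻¹)).tendsto g
  have h2 : Tendsto (fun x : G => x * h⁻¹) (𝓝 h) (𝓝 1) := by
    simpa using (hright h⁻¹).tendsto h
  have h3 : Tendsto (fun x : G => g * a⁻¹ * x * h) (𝓝 a) (𝓝 (g * h)) := by
    simpa [Function.comp_def] using ((hright h).comp (hleft (g * a⁻¹))).tendsto a
  have h4 := h3.comp (hcont.comp (h1.prodMap h2))
  rw [ContinuousAt, nhds_prod_eq]
  simpa [Function.comp_def, mul_assoc] using h4

/-- In a compact Hausdorff right topological group, the closure of a subgroup of the topological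
center is a subgroup. -/
def closureSubgroup [CompactSpace G] [T2Space G]
    (hright : ∀ h : G, Continuous fun g : G => g * h) (S : Subgroup G)
    (hS : ∀ g ∈ S, Continuous fun h : G => g * h) : Subgroup G :=
  have hmul : ∀ {a b : G}, a ∈ closure (S : Set G) → b ∈ closure (S : Set G) →
      a * b ∈ closure (S : Set G) := by
    intro a b ha hb
    have h1 : ∀ s ∈ (S : Set G), s * b ∈ closure (S : Set G) := fun s hs =>
      map_mem_closure (hS s hs) hb fun t ht => S.mul_mem hs ht
    simpa using map_mem_closure (hright b) ha h1
  { carrier := closure (S : Set G)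
    mul_mem' := hmul
    one_mem' := subset_closure S.one_mem
    inv_mem' := by
      intro x hx
      obtain ⟨m, ⟨y, hy, rfl⟩, hm⟩ := exists_idempotent_in_compact_subsemigroup hright
        ((fun g : G => g * x) '' closure (S : Set G))
        ⟨_, mem_image_of_mem _ (subset_closure S.one_mem)⟩
        (isClosed_closure.isCompact.image (hright x))
        (by
          rintro _ ⟨y, hy, rfl⟩ _ ⟨z, hz, rfl⟩
          exact ⟨y * x * z, hmul (hmul hy hx) hz, by simp only [mul_assoc]⟩)
      have h1 : y * x = 1 := mul_eq_left.1 hm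
      rwa [← eq_inv_of_mul_eq_one_left h1] }

/-- If the topological center is dense and `1` has a countable π-base, then some continuous map to
`ℕ → ℝ` takes its value at `1` only once. -/
theorem exists_continuous_eq_one_of_eq [CompactSpace G] [T2Space G]
    (hright : ∀ h : G, Continuous fun g : G => g * h)
    (hadm : Dense {g : G | Continuous fun h : G => g * h})
    (hpi : ∃ B : Set (Set G), B.Countable ∧ (∀ U ∈ B, IsOpen U ∧ U.Nonempty) ∧
      ∀ V : Set G, IsOpen V → (1 : G) ∈ V → ∃ U ∈ B, U ⊆ V) :
    ∃ Φ : G → ℕ → ℝ, Continuous Φ ∧ ∀ y, Φ y = Φ 1 → y = 1 := by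
  obtain ⟨B, hBc, hB, hBV⟩ := hpi
  have hne : B.Nonempty := let ⟨U, hU, _⟩ := hBV univ isOpen_univ (mem_univ _); ⟨U, hU⟩
  obtain ⟨U, rfl⟩ := hBc.exists_eq_range hne
  simp only [forall_mem_range, exists_range_iff] at hB hBV
  have hD : ∀ n, IsOpen {y : G | ∃ u ∈ U n, u * y ∈ U n} := by
    intro n
    refine isOpen_iff_mem_nhds.2 fun y ⟨u, hu, huy⟩ => ?_
    obtain ⟨l, ⟨hlU, hly⟩, hl⟩ := hadm.inter_open_nonempty _
      ((hB n).1.inter ((hB n).1.preimage (hright y))) ⟨u, hu, huy⟩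
    exact mem_of_superset (((hB n).1.preimage hl).mem_nhds hly) fun z hz => ⟨l, hlU, hz⟩
  have h1D : ∀ n, (1 : G) ∈ {y : G | ∃ u ∈ U n, u * y ∈ U n} := fun n =>
    let ⟨u, hu⟩ := (hB n).2; ⟨u, hu, by simpa using hu⟩
  have hsep : ∀ y : G, (∀ n, y ∈ {y : G | ∃ u ∈ U n, u * y ∈ U n}) → y = 1 := by
    intro y hy
    by_contra hy1
    obtain ⟨V, W, hV, hW, hyV, h1W, hVW⟩ := t2_separation hy1
    obtain ⟨n, hn⟩ := hBV (W ∩ (fun g => g * y) ⁻¹' V) (hW.inter (hV.preimage (hright y)))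
      ⟨h1W, by simpa using hyV⟩
    obtain ⟨u, hu, huy⟩ := hy n
    exact disjoint_left.1 hVW (hn hu).2 (hn huy).1
  choose F hF0 hF1 _ using fun n => exists_continuous_zero_one_of_isClosed
    (isClosed_singleton (x := (1 : G))) (hD n).isClosed_compl
    (disjoint_singleton_left.2 fun h => h (h1D n))
  refine ⟨fun y n => F n y, continuous_pi fun n => (F n).continuous, fun y hy => hsep y fun n => ?_⟩
  by_contra hn
  have h0 := hF0 n (mem_singleton (1 : G))
  have h1 := hF1 n hn
  have h2 := congrFun hy n
  simp_all

/-- A compact right topological group is first countable if some continuous map to `ℕ → ℝ` takes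
its value at `1` only once. -/
theorem firstCountableTopology_of_continuous_eq_one [CompactSpace G]
    (hright : ∀ h : G, Continuous fun g : G => g * h) {Φ : G → ℕ → ℝ} (hΦ : Continuous Φ)
    (hΦ1 : ∀ y, Φ y = Φ 1 → y = 1) : FirstCountableTopology G := by
  have h1 : (𝓝 (1 : G)).IsCountablyGenerated := by
    have : Φ ⁻¹' {Φ 1} = {1} := by
      ext y
      exact ⟨hΦ1 y, fun h => congrArg Φ h⟩
    rw [← nhdsSet_singleton, ← this, ← hΦ.isClosedMap.comap_nhds_eq hΦ]
    infer_instance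
  refine ⟨fun a => ?_⟩
  have h2 : 𝓝 a = comap (fun g => g * a⁻¹) (𝓝 1) := by
    let e : G ≃ₜ G :=
      { Equiv.mulRight a⁻¹ with
        continuous_toFun := hright a⁻¹
        continuous_invFun := by simpa using hright a }
    have h := e.comap_nhds_eq (1 : G)
    rw [show e.symm 1 = a from show 1 * a⁻¹⁻¹ = a by simp] at h
    exact h.symm
  rw [h2]
  infer_instance

/-- If a continuous map to `ℕ → ℝ` takes its value at `1` only once, then the closure of a
countable subgroup of the topological center is metrizable. -/
theorem metrizableSpace_closureSubgroup [CompactSpace G] [T2Space G]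
    (hright : ∀ h : G, Continuous fun g : G => g * h) {Φ : G → ℕ → ℝ} (hΦ : Continuous Φ)
    (hΦ1 : ∀ y, Φ y = Φ 1 → y = 1) (S : Subgroup G) [Countable S]
    (hS : ∀ g ∈ S, Continuous fun h : G => g * h) :
    TopologicalSpace.MetrizableSpace (closureSubgroup hright S hS) := by
  set H := closureSubgroup hright S hS
  have : CompactSpace H := isCompact_iff_compactSpace.1 isClosed_closure.isCompact
  have hcont : Continuous fun (y : H) (s : S) => Φ (s * y) :=
    continuous_pi fun s => hΦ.comp ((hS s s.2).comp continuous_subtype_val)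
  have hinj : Function.Injective fun (y : H) (s : S) => Φ (s * y) := by
    intro y z hyz
    have hcl : ∀ q ∈ closure (S : Set G), Φ (q * y) = Φ (q * z) := fun q hq =>
      closure_minimal (t := {q : G | Φ (q * y) = Φ (q * z)})
        (fun s hs => congrFun hyz ⟨s, hs⟩)
        (isClosed_eq (hΦ.comp (hright y)) (hΦ.comp (hright z))) hq
    have h := hcl (y⁻¹ : H) (y⁻¹ : H).2
    have h1 := hΦ1 ((y : G)⁻¹ * z) (by simpa using h.symm)
    exact Subtype.ext (inv_mul_eq_one.1 h1)
  exact (hcont.isClosedEmbedding hinj).isEmbedding.metrizableSpace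

/-- A compact Hausdorff group with continuous multiplication is a topological group. -/
theorem isTopologicalGroup_of_compactSpace [CompactSpace G] [T2Space G] [ContinuousMul G] :
    IsTopologicalGroup G := by
  let e : G × G ≃ G × G :=
    { toFun := fun p => (p.1, p.1 * p.2)
      invFun := fun p => (p.1, p.1⁻¹ * p.2)
      left_inv := fun p => by simp
      right_inv := fun p => by simp }
  have he : Continuous e := by
    change Continuous fun p : G × G => (p.1, p.1 * p.2)
    fun_prop
  have hs := (he.homeoOfEquivCompactToT2).symm.continuous
  refine { continuous_inv := ?_ }
  have h : Continuous fun x : G => (he.homeoOfEquivCompactToT2.symm (x, 1)).2 :=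
    continuous_snd.comp (hs.comp (by fun_prop))
  convert h using 2 with x
  change x⁻¹ = x⁻¹ * 1
  simp

/-- If some continuous map from a CHART group to `ℕ → ℝ` takes its value at `1` only once, then
multiplication is continuous. -/
theorem continuousMul_of_continuous_eq_one [CompactSpace G] [T2Space G]
    (hright : ∀ h : G, Continuous fun g : G => g * h)
    (hadm : Dense {g : G | Continuous fun h : G => g * h}) {Φ : G → ℕ → ℝ} (hΦ : Continuous Φ)
    (hΦ1 : ∀ y, Φ y = Φ 1 → y = 1) : ContinuousMul G := by
  have := firstCountableTopology_of_continuous_eq_one hright hΦ hΦ1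
  refine ⟨continuous_iff_seqContinuous.2 fun p q hpq => ?_⟩
  choose u hu hux using fun x : G => mem_closure_iff_seq_limit.1 (hadm x)
  let T : Set G := insert q.1 (insert q.2
    (range (fun n => (p n).1) ∪ range (fun n => (p n).2)))
  have hT : T.Countable :=
    (((countable_range _).union (countable_range _)).insert _).insert _
  let S := Subgroup.closure (⋃ x ∈ T, range (u x))
  have : Countable S := Subgroup.countable_closure (hT.biUnion fun x _ => countable_range _)
  have hS : ∀ g ∈ S, Continuous fun h : G => g * h := by
    intro g hg
    induction hg using Subgroup.closure_induction with
    | mem x hx =>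
      simp only [mem_iUnion] at hx
      obtain ⟨y, _, n, rfl⟩ := hx
      exact hu y n
    | one => simpa using continuous_id'
    | mul x y _ _ hx hy => simpa [Function.comp_def, mul_assoc] using hx.comp hy
    | inv x _ hx =>
      exact (Continuous.homeoOfEquivCompactToT2 (f := Equiv.mulLeft x) hx).symm.continuous
  let H := closureSubgroup hright S hS
  have : CompactSpace H := isCompact_iff_compactSpace.1 isClosed_closure.isCompact
  have : TopologicalSpace.MetrizableSpace H :=
    metrizableSpace_closureSubgroup hright hΦ hΦ1 S hS
  have hTH : ∀ x ∈ T, x ∈ H := fun x hx =>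
    mem_closure_of_tendsto (hux x) (Eventually.of_forall fun n =>
      Subgroup.subset_closure (mem_biUnion (t := fun x => range (u x)) hx (mem_range_self n)))
  have hrightH : ∀ h : H, Continuous fun g : H => g * h := fun h =>
    ((hright h).comp continuous_subtype_val).subtype_mk _
  have hadmH : Dense {g : H | Continuous fun h : H => g * h} := by
    have hd : Dense {g : H | (g : G) ∈ S} := by
      intro x
      rw [closure_subtype]
      refine closure_mono (fun s hs => ?_) x.2
      exact ⟨⟨s, subset_closure hs⟩, hs, rfl⟩
    exact hd.mono fun g hg => ((hS g hg).comp continuous_subtype_val).subtype_mk _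
  have := continuousMul_of_metrizable hrightH hadmH
  have h1 : ∀ n, (p n).1 ∈ H := fun n => hTH _ (by simp [T])
  have h2 : ∀ n, (p n).2 ∈ H := fun n => hTH _ (by simp [T])
  have t1 : Tendsto (fun n => (⟨_, h1 n⟩ : H)) atTop (𝓝 ⟨q.1, hTH _ (by simp [T])⟩) :=
    tendsto_subtype_rng.2 ((continuous_fst.tendsto q).comp hpq)
  have t2 : Tendsto (fun n => (⟨_, h2 n⟩ : H)) atTop (𝓝 ⟨q.2, hTH _ (by simp [T])⟩) :=
    tendsto_subtype_rng.2 ((continuous_snd.tendsto q).comp hpq)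
  exact tendsto_subtype_rng.1 (t1.mul t2)

/-- A first countable Hausdorff topological group is metrizable. -/
theorem metrizableSpace_of_firstCountable [IsTopologicalGroup G] [T2Space G]
    [FirstCountableTopology G] : TopologicalSpace.MetrizableSpace G := by
  let := IsTopologicalGroup.rightUniformSpace G
  have : (uniformity G).IsCountablyGenerated := by
    rw [uniformity_eq_comap_nhds_one']
    infer_instance
  exact UniformSpace.metrizableSpace

end RightTopologicalGroup

/-- Every CHART group (compact Hausdorff admissible right topological group)
with countable π-character is metrizable. -/
theorem metrizable_of_chart_countable_piCharacter {G : Type*} [Group G] [TopologicalSpace G]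
    [CompactSpace G] [T2Space G]
    (hright : ∀ h : G, Continuous fun g : G => g * h)
    (hadm : Dense {g : G | Continuous fun h : G => g * h})
    (hpi : ∀ x : G, ∃ B : Set (Set G), B.Countable ∧
      (∀ U ∈ B, IsOpen U ∧ U.Nonempty) ∧
      ∀ V : Set G, IsOpen V → x ∈ V → ∃ U ∈ B, U ⊆ V) :
    TopologicalSpace.MetrizableSpace G := by
  obtain ⟨Φ, hΦ, hΦ1⟩ := exists_continuous_eq_one_of_eq hright hadm (hpi 1)
  have := firstCountableTopology_of_continuous_eq_one hright hΦ hΦ1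
  have := continuousMul_of_continuous_eq_one hright hadm hΦ hΦ1
  have := isTopologicalGroup_of_compactSpace (G := G)
  exact metrizableSpace_of_firstCountable
end

section
/- Every compact Hausdorff admissible right topological (CHART) group of countable tightness is metrizable. -/
open Set Topology

/-- Every point in the closure of a set lies in the closure of a countable subset of it. -/
def HasCountableTightness (X : Type*) [TopologicalSpace X] : Prop :=
  ∀ (A : Set X) (x : X), x ∈ closure A → ∃ B ⊆ A, B.Countable ∧ x ∈ closure B

/-- The well-ordered type of all countable ordinals. -/
abbrev CountableOrdinals : Type := (Cardinal.aleph 1).ord.ToType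

lemma CountableOrdinals.countable_Iio (i : CountableOrdinals) : (Iio i).Countable := by
  have h : Cardinal.mk (Iio i) < Cardinal.mk CountableOrdinals :=
    Cardinal.mk_Iio_lt i (by rw [Cardinal.mk_ord_toType, Ordinal.type_toType])
  have h' := (h.trans_eq (Cardinal.mk_ord_toType _)).trans_eq Cardinal.succ_aleph0.symm
  exact Cardinal.le_aleph0_iff_set_countable.1 (Order.lt_succ_iff.1 h')

lemma CountableOrdinals.not_countable_univ : ¬ (univ : Set CountableOrdinals).Countable := by
  rw [← Cardinal.le_aleph0_iff_set_countable, Cardinal.mk_univ, Cardinal.mk_ord_toType, not_le]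
  exact Cardinal.aleph0_lt_aleph_one

lemma CountableOrdinals.exists_forall_lt {s : Set CountableOrdinals} (hs : s.Countable) :
    ∃ i, ∀ j ∈ s, j < i := by
  by_contra! h
  refine CountableOrdinals.not_countable_univ
    (((hs.biUnion fun j _ => CountableOrdinals.countable_Iio j).union hs).mono fun i _ => ?_)
  obtain ⟨j, hj, hij⟩ := h i
  rcases hij.lt_or_eq with hlt | rfl
  · exact Or.inl (mem_biUnion hj hlt)
  · exact Or.inr hj

/-- Transfinite construction of a sequence whose terms are related to the set of earlier terms. -/
lemma exists_transfinite_sequence {α : Type*} (P : Set α → α → Prop)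
    (hP : ∀ s : Set α, s.Countable → ∃ a, P s a) :
    ∃ f : CountableOrdinals → α, ∀ i, P (f '' Iio i) (f i) := by
  classical
  obtain ⟨a₀, -⟩ := hP ∅ countable_empty
  let g : Set α → α := fun s => if h : ∃ a, P s a then h.choose else a₀
  have hg : ∀ s : Set α, s.Countable → P s (g s) := fun s hs => by
    simp only [g, dif_pos (hP s hs)]
    exact (hP s hs).choose_spec
  let F : ∀ i : CountableOrdinals, (∀ j, j < i → α) → α :=
    fun i ih => g (range fun j : Iio i => ih j.1 j.2)
  refine ⟨wellFounded_lt.fix F, fun i => ?_⟩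
  rw [wellFounded_lt.fix_eq F i, image_eq_range]
  have : Countable (Iio i) := (CountableOrdinals.countable_Iio i).to_subtype
  exact hg _ (countable_range _)

/-- A compact space of countable tightness has no free sequence of length `ω₁`. -/
lemma HasCountableTightness.false_of_free_sequence {X : Type*} [TopologicalSpace X] [CompactSpace X]
    (hX : HasCountableTightness X) (x : CountableOrdinals → X)
    (h : ∀ i, Disjoint (closure (x '' Iio i)) (closure (x '' Ici i))) : False := by
  have : Nonempty CountableOrdinals :=
    (CountableOrdinals.exists_forall_lt countable_empty).nonempty
  have hne : (⋂ i, closure (x '' Ici i)).Nonempty := by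
    refine IsCompact.nonempty_iInter_of_directed_nonempty_isCompact_isClosed _ ?_ ?_
      (fun i => isClosed_closure.isCompact) (fun i => isClosed_closure)
    · refine directed_of_isDirected_le fun i j hij => closure_mono (image_mono ?_)
      exact Ici_subset_Ici.2 hij
    · exact fun i => (nonempty_Ici.image x).closure
  obtain ⟨z, hz⟩ := hne
  rw [mem_iInter] at hz
  obtain ⟨B, hB, hBc, hzB⟩ := hX (range x) z
    (closure_mono (image_subset_range _ _) (hz (Classical.arbitrary _)))
  obtain ⟨s, hs, rfl⟩ : ∃ s : Set CountableOrdinals, s.Countable ∧ B = x '' s := by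
    choose! k hk using show ∀ b ∈ B, ∃ i, x i = b from fun _ hb => hB hb
    refine ⟨k '' B, hBc.image k, ?_⟩
    rw [image_image]
    ext b
    constructor
    · exact fun hb => ⟨b, hb, hk b hb⟩
    · rintro ⟨c, hc, rfl⟩
      simpa only [hk c hc]
  obtain ⟨i, hi⟩ := CountableOrdinals.exists_forall_lt hs
  exact (h i).le_bot ⟨closure_mono (image_mono hi) hzB, hz i⟩

/-- **Shapirovskii**: points of a compact Hausdorff space of countable tightness have countable
`π`-character. -/
lemma HasCountableTightness.exists_countable_local_pi_base {X : Type*} [TopologicalSpace X]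
    [CompactSpace X] [T2Space X] (hX : HasCountableTightness X) (x : X) :
    ∃ 𝒱 : Set (Set X), 𝒱.Countable ∧ (∀ V ∈ 𝒱, IsOpen V ∧ V.Nonempty) ∧
      ∀ O, IsOpen O → x ∈ O → ∃ V ∈ 𝒱, V ⊆ O := by
  by_contra! hcon
  let Q := {p : Set X × Set X // IsOpen p.1 ∧ x ∈ p.1 ∧ closure p.1 ⊆ p.2 ∧ IsOpen p.2}
  let subbasis : Set Q → Set (Set X) := fun s =>
    (fun q : Q => q.1.1) '' s ∪ (fun q : Q => (closure q.1.2)ᶜ) '' s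
  obtain ⟨p, hp⟩ := exists_transfinite_sequence (α := Q)
    (fun s q => ∀ t, t.Finite → t ⊆ subbasis s → (⋂₀ t).Nonempty → ¬ ⋂₀ t ⊆ closure q.1.2) (by
      intro s hs
      have hc : (subbasis s).Countable := (hs.image _).union (hs.image _)
      obtain ⟨O, hO, hxO, hV⟩ := hcon
        ((fun t => ⋂₀ t) '' {t | t.Finite ∧ t ⊆ subbasis s} ∩ {U | U.Nonempty})
        (((countable_ofPred_finite_subset hc).image _).mono inter_subset_left) (by
          rintro _ ⟨⟨t, ⟨htf, hts⟩, rfl⟩, hne⟩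
          refine ⟨htf.isOpen_sInter fun U hU => ?_, hne⟩
          rcases hts hU with ⟨q, -, rfl⟩ | ⟨q, -, rfl⟩
          · exact q.2.1
          · exact isClosed_closure.isOpen_compl)
      obtain ⟨W, hW, hxW, hWO⟩ := normal_exists_closure_subset isClosed_singleton hO
        (singleton_subset_iff.2 hxO)
      obtain ⟨V, hV', hxV, hVW⟩ := normal_exists_closure_subset isClosed_singleton hW hxW
      refine ⟨⟨(V, W), hV', hxV rfl, hVW, hW⟩, fun t htf hts hne hsub => ?_⟩
      exact hV _ ⟨⟨t, ⟨htf, hts⟩, rfl⟩, hne⟩ (hsub.trans hWO))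
  have hfin : ∀ (i : CountableOrdinals) (s t : Finset CountableOrdinals), (∀ j ∈ s, j ≤ i) →
      (∀ j ∈ t, i < j) →
      ((⋂ j ∈ s, (p j).1.1) ∩ ⋂ j ∈ t, (closure (p j).1.2)ᶜ).Nonempty := by
    intro i s t hs
    induction t using Finset.induction_on_max with
    | empty => exact fun _ => ⟨x, by simpa using fun j _ => (p j).2.2.1⟩
    | insert a t hta ih =>
      intro ht
      have hne := ih fun j hj => ht j (Finset.mem_insert_of_mem hj)
      have hia : i < a := ht a (Finset.mem_insert_self _ _)
      have heq : ((⋂ j ∈ s, (p j).1.1) ∩ ⋂ j ∈ t, (closure (p j).1.2)ᶜ) =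
          ⋂₀ ((fun j => (p j).1.1) '' s ∪ (fun j => (closure (p j).1.2)ᶜ) '' t) := by
        simp only [sInter_union, sInter_image, Finset.mem_coe]
      have := hp a ((fun j => (p j).1.1) '' s ∪ (fun j => (closure (p j).1.2)ᶜ) '' t)
        ((s.finite_toSet.image _).union (t.finite_toSet.image _))
        (by
          refine union_subset_union ?_ ?_
          · rintro _ ⟨j, hj, rfl⟩
            exact ⟨p j, mem_image_of_mem _ ((hs j hj).trans_lt hia), rfl⟩
          · rintro _ ⟨j, hj, rfl⟩
            exact ⟨p j, mem_image_of_mem _ (hta j hj), rfl⟩)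
        (heq ▸ hne)
      rw [← heq, not_subset] at this
      obtain ⟨z, ⟨hz₁, hz₂⟩, hza⟩ := this
      refine ⟨z, hz₁, ?_⟩
      rw [Finset.set_biInter_insert]
      exact ⟨hza, hz₂⟩
  have hpt : ∀ i, ∃ z, ∀ j, (j ≤ i → z ∈ closure (p j).1.1) ∧ (i < j → z ∉ (p j).1.2) := by
    intro i
    let K : CountableOrdinals → Set X := fun j =>
      if j ≤ i then closure (p j).1.1 else ((p j).1.2)ᶜ
    obtain ⟨z, -, hz⟩ := isCompact_univ.inter_iInter_nonempty K
      (fun j => by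
        by_cases hj : j ≤ i
        · simp [K, hj]
        · simpa [K, hj] using (p j).2.2.2.2)
      (fun u => by
        obtain ⟨z, hz₁, hz₂⟩ := hfin i (u.filter (· ≤ i)) (u.filter (i < ·))
          (by simp) (by simp)
        refine ⟨z, mem_univ _, mem_iInter₂.2 fun j hj => ?_⟩
        simp only [mem_iInter, Finset.mem_filter] at hz₁ hz₂
        by_cases hji : j ≤ i
        · simp only [K, if_pos hji]
          exact subset_closure (hz₁ j ⟨hj, hji⟩)
        · simp only [K, if_neg hji]
          exact fun hzW => hz₂ j ⟨hj, not_le.1 hji⟩ (subset_closure hzW))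
    refine ⟨z, fun j => ⟨fun hj => ?_, fun hj => ?_⟩⟩
    · simpa [K, hj] using mem_iInter.1 hz j
    · simpa [K, not_le.2 hj] using mem_iInter.1 hz j
  choose z hz using hpt
  refine hX.false_of_free_sequence z fun i => ?_
  have h₁ : closure (z '' Iio i) ⊆ ((p i).1.2)ᶜ :=
    closure_minimal (by rintro _ ⟨j, hj, rfl⟩; exact (hz j i).2 hj)
      (p i).2.2.2.2.isClosed_compl
  have h₂ : closure (z '' Ici i) ⊆ closure (p i).1.1 :=
    closure_minimal (by rintro _ ⟨j, hj, rfl⟩; exact (hz j i).1 hj) isClosed_closure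
  exact (disjoint_compl_left.mono_right (p i).2.2.2.1).mono h₁ h₂

lemma Subgroup.countable_closure_of_countable {G : Type*} [Group G] {s : Set G}
    (hs : s.Countable) : (Subgroup.closure s : Set G).Countable := by
  have : Countable s := hs.to_subtype
  have : Countable (FreeGroup s) := Quot.mk_surjective.countable
  have h : (Subgroup.closure s : Set G) = range (FreeGroup.lift ((↑) : s → G)) := by
    rw [← MonoidHom.coe_range, FreeGroup.range_lift_eq_closure, Subtype.range_coe]
  rw [h]
  exact countable_range _

section RightTopologicalGroup

variable {G : Type*} [Group G] [TopologicalSpace G]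

/-- The right translation by `h` as a homeomorphism. -/
def rightTranslation (hright : ∀ h : G, Continuous fun g : G => g * h) (h : G) : G ≃ₜ G where
  toEquiv := Equiv.mulRight h
  continuous_toFun := hright h
  continuous_invFun := hright h⁻¹

/-- In a compact right topological group of countable tightness, every open neighborhood of `1` has
a product with a separable closed set that exhausts the group. -/
lemma HasCountableTightness.exists_countable_mul_closure_eq_univ [CompactSpace G]
    (hG : HasCountableTightness G) (hright : ∀ h : G, Continuous fun g : G => g * h)
    {W : Set G} (hW : IsOpen W) (h1 : (1 : G) ∈ W) :
    ∃ C : Set G, C.Countable ∧ ∀ g, ∃ w ∈ W, ∃ h ∈ closure C, w * h = g := by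
  by_contra! hcon
  obtain ⟨x, hx⟩ := exists_transfinite_sequence
    (fun (C : Set G) g => ∀ w ∈ W, ∀ h ∈ closure C, w * h ≠ g) hcon
  refine hG.false_of_free_sequence x fun i => ?_
  let U : Set G := ⋃ h ∈ closure (x '' Iio i), (rightTranslation hright h) '' W
  have hU : IsOpen U := isOpen_biUnion fun h _ =>
    (rightTranslation hright h).isOpenMap W hW
  have hleft : closure (x '' Iio i) ⊆ U := fun h hh =>
    mem_biUnion hh ⟨1, h1, one_mul h⟩
  have hright' : closure (x '' Ici i) ⊆ Uᶜ := by
    refine closure_minimal ?_ hU.isClosed_compl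
    rintro _ ⟨j, hj, rfl⟩ hjU
    simp only [U, mem_iUnion] at hjU
    obtain ⟨h, hh, w, hw, hwh⟩ := hjU
    exact hx j w hw h (closure_mono (image_mono (Iio_subset_Iio hj)) hh) hwh
  exact disjoint_compl_right.mono hleft hright'

/-- In a compact Hausdorff group, the continuous left translations form a subgroup. -/
def topologicalCenter (G : Type*) [Group G] [TopologicalSpace G] [CompactSpace G] [T2Space G] :
    Subgroup G where
  carrier := {g : G | Continuous fun h : G => g * h}
  one_mem' := by simpa using continuous_id'
  mul_mem' {a b} ha hb := by
    simpa [mul_assoc] using Continuous.comp (g := fun h : G => a * h) ha hb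
  inv_mem' {a} ha :=
    (Continuous.homeoOfEquivCompactToT2 (f := Equiv.mulLeft a) ha).symm.continuous

variable [CompactSpace G] [T2Space G]

/-- The left translation by an element of the topological center as a homeomorphism. -/
def leftTranslation {a : G} (ha : a ∈ topologicalCenter G) : G ≃ₜ G where
  toEquiv := Equiv.mulLeft a
  continuous_toFun := ha
  continuous_invFun := (topologicalCenter G).inv_mem ha

/-- The closure of a subgroup of the topological center is a subgroup. -/
def closureOfLeTopologicalCenter (hright : ∀ h : G, Continuous fun g : G => g * h)
    {A : Subgroup G} (hA : A ≤ topologicalCenter G) : Subgroup G :=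
  have mul_mem {x y : G} (hx : x ∈ closure (A : Set G)) (hy : y ∈ closure (A : Set G)) :
      x * y ∈ closure (A : Set G) := by
    have hleft : ∀ a ∈ (A : Set G), a * y ∈ closure (A : Set G) := fun a ha =>
      map_mem_closure (hA ha) hy fun b hb => A.mul_mem ha hb
    simpa using map_mem_closure (hright y) hx hleft
  { carrier := closure (A : Set G)
    mul_mem' := mul_mem
    one_mem' := subset_closure A.one_mem
    inv_mem' := by
      intro g hg
      obtain ⟨m, ⟨k, hk, rfl⟩, hm⟩ := exists_idempotent_in_compact_subsemigroup hright
        ((fun x => x * g) '' closure (A : Set G)) ⟨_, mem_image_of_mem _ hg⟩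
        (isClosed_closure.isCompact.image (hright g)) (by
          rintro _ ⟨x, hx, rfl⟩ _ ⟨y, hy, rfl⟩
          exact ⟨x * g * y, mul_mem (mul_mem hx hg) hy, by simp [mul_assoc]⟩)
      have : k * g = 1 := by simpa using hm
      rwa [← eq_inv_of_mul_eq_one_left this] }

/-- A CHART group of countable tightness is separable, by elements of its topological center. -/
lemma HasCountableTightness.exists_countable_dense_le_topologicalCenter
    (hG : HasCountableTightness G) (hright : ∀ h : G, Continuous fun g : G => g * h)
    (hadm : Dense (topologicalCenter G : Set G)) :
    ∃ A : Set G, A.Countable ∧ A ⊆ topologicalCenter G ∧ Dense A := by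
  obtain ⟨𝒱, h𝒱c, h𝒱, hbase⟩ := hG.exists_countable_local_pi_base (1 : G)
  have hstep : ∀ V ∈ 𝒱, ∃ D : Set G, D.Countable ∧ D ⊆ topologicalCenter G ∧
      ∃ a ∈ D, ∀ g, ∃ v ∈ V, ∃ h ∈ closure D, v * a⁻¹ * h = g := by
    intro V hV
    obtain ⟨hVo, hVne⟩ := h𝒱 V hV
    obtain ⟨a, haV, ha⟩ := hadm.inter_open_nonempty V hVo hVne
    obtain ⟨C, hC, hCG⟩ := hG.exists_countable_mul_closure_eq_univ hright
      (hVo.preimage (hright a)) (by simpa using haV)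
    choose B hBsub hBc hB using fun c : G => hG _ c (hadm c)
    refine ⟨insert a (⋃ c ∈ C, B c), (hC.biUnion fun c _ => hBc c).insert a,
      insert_subset ha (iUnion₂_subset fun c _ => hBsub c), a, mem_insert _ _, fun g => ?_⟩
    obtain ⟨w, hw, h, hh, rfl⟩ := hCG g
    refine ⟨w * a, hw, h, ?_, by simp⟩
    refine closure_minimal (fun c hc => ?_) isClosed_closure hh
    exact closure_mono ((subset_biUnion_of_mem hc).trans (subset_insert _ _)) (hB c)
  choose! D hDc hDsub a haD hDG using hstep
  let A : Subgroup G := Subgroup.closure (⋃ V ∈ 𝒱, D V)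
  have hDA : ∀ V ∈ 𝒱, D V ⊆ A := fun V hV =>
    (subset_biUnion_of_mem hV).trans Subgroup.subset_closure
  have hA : A ≤ topologicalCenter G := (Subgroup.closure_le _).2 (iUnion₂_subset hDsub)
  let H : Subgroup G := closureOfLeTopologicalCenter hright hA
  have hAH : (A : Set G) ⊆ H := subset_closure
  refine ⟨A, Subgroup.countable_closure_of_countable (h𝒱c.biUnion hDc), hA, ?_⟩
  have hmeet : ∀ V ∈ 𝒱, ∀ g, ∃ h ∈ H, g * h ∈ V := by
    intro V hV g
    obtain ⟨v, hv, h, hh, rfl⟩ := hDG V hV g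
    have hhH : h ∈ H := closure_mono (hDA V hV) hh
    refine ⟨h⁻¹ * a V, H.mul_mem (H.inv_mem hhH) (hAH (hDA V hV (haD V hV))), ?_⟩
    simpa [mul_assoc] using hv
  have hcenter : (topologicalCenter G : Set G) ⊆ H := by
    intro g hg
    have h1 : (1 : G) ∈ (leftTranslation hg) '' (H : Set G) := by
      have hcl : IsClosed ((leftTranslation hg) '' (H : Set G)) :=
        (leftTranslation hg).isClosedMap _ isClosed_closure
      rw [← hcl.closure_eq, mem_closure_iff]
      intro O hO h1O
      obtain ⟨V, hV, hVO⟩ := hbase O hO h1O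
      obtain ⟨h, hh, hgh⟩ := hmeet V hV g
      exact ⟨g * h, hVO hgh, h, hh, rfl⟩
    obtain ⟨h, hh, hgh⟩ := h1
    have : g = h⁻¹ := eq_inv_of_mul_eq_one_left hgh
    exact this ▸ H.inv_mem hh
  intro g
  exact closure_minimal hcenter isClosed_closure (hadm g)

/-- A compact Hausdorff right topological group with a countable local `π`-base at `1` and a
countable dense subset of its topological center is metrizable. -/
lemma metrizableSpace_of_countable_local_pi_base
    (hright : ∀ h : G, Continuous fun g : G => g * h) {A : Set G} (hAc : A.Countable)
    (hA : A ⊆ topologicalCenter G) (hAd : Dense A) {𝒱 : Set (Set G)} (h𝒱c : 𝒱.Countable)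
    (h𝒱 : ∀ V ∈ 𝒱, IsOpen V ∧ V.Nonempty)
    (hbase : ∀ O, IsOpen O → (1 : G) ∈ O → ∃ V ∈ 𝒱, V ⊆ O) :
    TopologicalSpace.MetrizableSpace G := by
  have hbump : ∀ V : 𝒱, ∃ (f : C(G, ℝ)) (x : G), f x = 1 ∧ x ∈ V.1 ∧ ∀ y ∉ V.1, f y = 0 := by
    rintro ⟨V, hV⟩
    obtain ⟨hVo, x, hx⟩ := h𝒱 V hV
    obtain ⟨f, hf₀, hf₁, -⟩ := exists_continuous_zero_one_of_isClosed hVo.isClosed_compl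
      (isClosed_singleton (x := x)) (by simpa using hx)
    exact ⟨f, x, hf₁ rfl, hx, fun y hy => hf₀ hy⟩
  choose f x hfx hxV hf₀ using hbump
  have : Countable 𝒱 := h𝒱c.to_subtype
  have : Countable A := hAc.to_subtype
  let F : G → 𝒱 × A → ℝ := fun g i => f i.1 (i.2 * g)
  have hF : Continuous F := continuous_pi fun i => (f i.1).continuous.comp (hA i.2.2)
  have hinj : Function.Injective F := by
    intro u v huv
    have hall : ∀ V g, f V (g * u) = f V (g * v) := by
      intro V
      refine congrFun (Continuous.ext_on hAd ((f V).continuous.comp (hright u))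
        ((f V).continuous.comp (hright v)) fun a ha => ?_)
      exact congrFun huv (V, ⟨a, ha⟩)
    by_contra hne
    have hq : (1 : G) ≠ u⁻¹ * v := fun h => hne (inv_mul_eq_one.1 h.symm)
    obtain ⟨O₁, O₂, hO₁, hO₂, h1, hq₂, hdisj⟩ := t2_separation hq
    obtain ⟨V, hV, hVO⟩ := hbase (O₁ ∩ (fun g => g * (u⁻¹ * v)) ⁻¹' O₂)
      (hO₁.inter (hO₂.preimage (hright _))) ⟨h1, by simpa using hq₂⟩
    have hxq : x ⟨V, hV⟩ * (u⁻¹ * v) ∈ V := by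
      by_contra hnot
      have := hall ⟨V, hV⟩ (x ⟨V, hV⟩ * u⁻¹)
      rw [inv_mul_cancel_right, hfx, mul_assoc, hf₀ ⟨V, hV⟩ _ hnot] at this
      exact one_ne_zero this
    exact hdisj.le_bot ⟨(hVO hxq).1, (hVO (hxV ⟨V, hV⟩)).2⟩
  exact (hF.isClosedEmbedding hinj).isEmbedding.metrizableSpace

end RightTopologicalGroup

/-- Every CHART group (compact Hausdorff admissible right topological group)
of countable tightness is metrizable. -/
theorem metrizable_of_chart_countable_tightness {G : Type*} [Group G] [TopologicalSpace G]
    [CompactSpace G] [T2Space G]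
    (hright : ∀ h : G, Continuous fun g : G => g * h)
    (hadm : Dense {g : G | Continuous fun h : G => g * h})
    (htight : ∀ (A : Set G) (x : G), x ∈ closure A →
      ∃ B ⊆ A, B.Countable ∧ x ∈ closure B) :
    TopologicalSpace.MetrizableSpace G := by
  have hG : HasCountableTightness G := htight
  obtain ⟨A, hAc, hA, hAd⟩ := hG.exists_countable_dense_le_topologicalCenter hright hadm
  obtain ⟨𝒱, h𝒱c, h𝒱, hbase⟩ := hG.exists_countable_local_pi_base (1 : G)
  exact metrizableSpace_of_countable_local_pi_base hright hAc hA hAd h𝒱c h𝒱 hbase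
end

section
/- Assume the continuum hypothesis (2^ℵ₀ = ℵ₁). Then every sequentially compact compact Hausdorff admissible right topological (CHART) group is metrizable. -/
open Set Filter Topology

/-- The point `p` has a countable local π-base. -/
def HasCountableLocalPiBase {X : Type*} [TopologicalSpace X] (p : X) : Prop :=
  ∃ U : ℕ → Set X, (∀ n, IsOpen (U n)) ∧ (∀ n, (U n).Nonempty) ∧ ∀ W ∈ 𝓝 p, ∃ n, U n ⊆ W

section PiBase

variable {X : Type*} [TopologicalSpace X]

/-- `D` is infinitely often inside each of two disjoint closed sets along `φ`, so that no sequence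
`x` with `x n ∈ D n` converges along `φ`. -/
def SplitsAlong (φ : ℕ → ℕ) (D : ℕ → Set X) : Prop :=
  ∃ A B : Set X, IsClosed A ∧ IsClosed B ∧ Disjoint A B ∧
    (∃ᶠ k in atTop, D (φ k) ⊆ A) ∧ ∃ᶠ k in atTop, D (φ k) ⊆ B

lemma SplitsAlong.not_tendsto {φ : ℕ → ℕ} {D : ℕ → Set X} (h : SplitsAlong φ D) {x : ℕ → X}
    (hx : ∀ n, x n ∈ D n) (p : X) : ¬ Tendsto (x ∘ φ) atTop (𝓝 p) := by
  obtain ⟨A, B, hA, hB, hAB, hfA, hfB⟩ := h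
  intro hp
  have hpA : p ∈ A := hA.mem_of_frequently_of_tendsto (hfA.mono fun k hk => hk (hx _)) hp
  have hpB : p ∈ B := hB.mem_of_frequently_of_tendsto (hfB.mono fun k hk => hk (hx _)) hp
  exact disjoint_left.1 hAB hpA hpB

/-- If no point has a countable local π-base, then countably many sequences of constraints can be
extended by a further one that destroys the convergence along a given subsequence. -/
lemma exists_splitsAlong [CompactSpace X] [T2Space X] [SeqCompactSpace X]
    (hno : ∀ p : X, ¬ HasCountableLocalPiBase p) {ι : Type*} [Countable ι] (C : ι → ℕ → Set X)
    (hC : ∀ n (s : Finset ι), (⋂ i ∈ s, interior (C i n)).Nonempty)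
    {φ : ℕ → ℕ} (hφ : StrictMono φ) :
    ∃ D : ℕ → Set X, (∀ n, IsClosed (D n)) ∧
      (∀ n (s : Finset ι), (interior (D n) ∩ ⋂ i ∈ s, interior (C i n)).Nonempty) ∧
      SplitsAlong φ D := by
  classical
  have hF : ∀ n, (⋂ s : Finset ι, closure (⋂ i ∈ s, interior (C i n))).Nonempty := by
    intro n
    refine IsCompact.nonempty_iInter_of_directed_nonempty_isCompact_isClosed _ ?_
      (fun s => (hC n s).closure) (fun s => isClosed_closure.isCompact) fun s => isClosed_closure
    intro s t
    exact ⟨s ∪ t, closure_mono (biInter_subset_biInter_left fun i hi => by simp_all),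
      closure_mono (biInter_subset_biInter_left fun i hi => by simp_all)⟩
  choose y hy using hF
  obtain ⟨p, ψ, hψ, hp⟩ := SeqCompactSpace.tendsto_subseq (y ∘ φ)
  obtain ⟨U, hU, hUC⟩ : ∃ U ∈ 𝓝 p, ∀ n (s : Finset ι), ¬ (⋂ i ∈ s, interior (C i n)) ⊆ U := by
    by_contra! h
    obtain ⟨e, he⟩ := exists_surjective_nat (ℕ × Finset ι)
    refine hno p ⟨fun m => ⋂ i ∈ (e m).2, interior (C i (e m).1), fun m => ?_,
      fun m => hC _ _, fun W hW => ?_⟩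
    · exact isOpen_biInter_finset fun i _ => isOpen_interior
    · obtain ⟨n, s, hns⟩ := h W hW
      obtain ⟨m, hm⟩ := he (n, s)
      exact ⟨m, by simpa [hm] using hns⟩
  obtain ⟨K, hK, hKcl, hKU⟩ := exists_mem_nhds_isClosed_subset hU
  obtain ⟨A, hA, hAcl, hAK⟩ := exists_mem_nhds_isClosed_subset (interior_mem_nhds.2 hK)
  obtain ⟨k₀, hk₀⟩ := eventually_atTop.1 (hp.eventually (interior_mem_nhds.2 hA))
  let E : Set ℕ := {n | ∃ k, k₀ ≤ k ∧ n = φ (ψ (2 * k))}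
  refine ⟨fun n => if n ∈ E then A else (interior K)ᶜ, fun n => ?_, fun n s => ?_, A,
    (interior K)ᶜ, hAcl, isOpen_interior.isClosed_compl, ?_, ?_, ?_⟩
  · dsimp only
    split_ifs
    exacts [hAcl, isOpen_interior.isClosed_compl]
  · by_cases hn : n ∈ E
    · obtain ⟨k, hk, rfl⟩ := hn
      have hn : φ (ψ (2 * k)) ∈ E := ⟨k, hk, rfl⟩
      simp only [hn, if_true]
      exact mem_closure_iff.1 (mem_iInter.1 (hy _) s) _ isOpen_interior (hk₀ (2 * k) (by omega))
    · simp only [hn, if_false]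
      obtain ⟨z, hz, hzU⟩ := not_subset.1 (hUC n s)
      refine ⟨z, ?_, hz⟩
      exact interior_maximal (compl_subset_compl.2 interior_subset) hKcl.isOpen_compl
        fun h => hzU (hKU h)
  · exact disjoint_compl_right.mono_left hAK
  · refine frequently_atTop.2 fun N => ⟨ψ (2 * (N + k₀)), ?_, ?_⟩
    · exact le_trans (by omega) hψ.le_apply
    · have hE : φ (ψ (2 * (N + k₀))) ∈ E := ⟨N + k₀, by omega, rfl⟩
      simp [hE]
  · refine frequently_atTop.2 fun N => ⟨ψ (2 * N + 1), le_trans (by omega) hψ.le_apply, ?_⟩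
    have hE : φ (ψ (2 * N + 1)) ∉ E := by
      rintro ⟨k, -, hk⟩
      have := hψ.injective (hφ.injective hk)
      omega
    simp [hE]

/-- If no point has a countable local π-base, then there is a sequence that converges along none of
the subsequences enumerated by a well-order with countable initial segments. -/
lemma exists_forall_not_tendsto [CompactSpace X] [T2Space X] [SeqCompactSpace X] [Nonempty X]
    (hno : ∀ p : X, ¬ HasCountableLocalPiBase p) {I : Type*} [LinearOrder I] [WellFoundedLT I]
    (hcount : ∀ a : I, Countable (Iio a)) (e : I → ℕ → ℕ) (he : ∀ a, StrictMono (e a)) :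
    ∃ x : ℕ → X, ∀ a p, ¬ Tendsto (x ∘ e a) atTop (𝓝 p) := by
  classical
  let Good (a : I) (hist : ∀ b, b < a → ℕ → Set X) (D : ℕ → Set X) : Prop :=
    (∀ n, IsClosed (D n)) ∧
      (∀ n (s : Finset (Iio a)),
        (interior (D n) ∩ ⋂ i ∈ s, interior (hist i.1 i.2 n)).Nonempty) ∧ SplitsAlong (e a) D
  let step (a : I) (hist : ∀ b, b < a → ℕ → Set X) : ℕ → Set X :=
    if h : ∃ D, Good a hist D then h.choose else fun _ => univ
  let C : I → ℕ → Set X := (wellFounded_lt (α := I)).fix step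
  have hCstep : ∀ a, C a = step a fun b _ => C b := fun a => WellFounded.fix_eq _ _ a
  have hfip : ∀ (n : ℕ) (s : Finset I), (∀ b ∈ s, Good b (fun b _ => C b) (C b)) →
      (⋂ i ∈ s, interior (C i n)).Nonempty := by
    intro n s hs
    rcases s.eq_empty_or_nonempty with rfl | hne
    · simp
    · obtain ⟨z, hz, hz'⟩ := (hs _ (s.max'_mem hne)).2.1 n (s.subtype (· ∈ Iio (s.max' hne)))
      refine ⟨z, mem_iInter₂.2 fun i hi => ?_⟩
      rcases (s.le_max' i hi).eq_or_lt with h | h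
      · rwa [h]
      · exact mem_iInter₂.1 hz' ⟨i, h⟩ (by simpa using hi)
  have hgood : ∀ a, Good a (fun b _ => C b) (C a) := by
    intro a
    induction a using WellFoundedLT.induction with
    | ind a ih =>
      have := hcount a
      have hex : ∃ D, Good a (fun b _ => C b) D := by
        refine exists_splitsAlong hno (fun i : Iio a => C i.1) (fun n s => ?_) (he a)
        have := hfip n (s.map (Function.Embedding.subtype _)) (by
          intro b hb
          obtain ⟨c, -, rfl⟩ := Finset.mem_map.1 hb
          exact ih _ c.2)
        simpa using this
      rw [hCstep a]
      simp only [step, dif_pos hex]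
      exact hex.choose_spec
  have hne : ∀ n, (⋂ a, C a n).Nonempty := by
    intro n
    have := isCompact_univ.inter_iInter_nonempty (fun a => C a n) (fun a => (hgood a).1 n)
      fun s => by
        obtain ⟨z, hz⟩ := hfip n s fun b _ => hgood b
        exact ⟨z, mem_univ z, mem_iInter₂.2 fun i hi => interior_subset (mem_iInter₂.1 hz i hi)⟩
    simpa using this
  choose x hx using hne
  exact ⟨x, fun a => (hgood a).2.2.not_tendsto fun n => mem_iInter.1 (hx n) a⟩

/-- Under the continuum hypothesis, every sequentially compact compact Hausdorff space has a point
with a countable local π-base. -/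
theorem exists_hasCountableLocalPiBase [CompactSpace X] [T2Space X] [SeqCompactSpace X]
    [Nonempty X] (hCH : (2 : Cardinal.{0}) ^ Cardinal.aleph0 = Cardinal.aleph 1) :
    ∃ p : X, HasCountableLocalPiBase p := by
  by_contra! hno
  let I := {φ : ℕ → ℕ // StrictMono φ}
  have hcard : Cardinal.mk I ≤ Cardinal.aleph 1 := by
    refine (Cardinal.mk_subtype_le _).trans ?_
    simp [← hCH]
  obtain ⟨_, _, hI⟩ := Cardinal.exists_ord_eq_type_lt I
  obtain ⟨x, hx⟩ := exists_forall_not_tendsto (I := I) hno (fun a => by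
    have h := (Cardinal.mk_Iio_lt a hI).trans_le hcard
    rwa [← Cardinal.succ_aleph0, Order.lt_succ_iff, Cardinal.mk_le_aleph0_iff] at h)
    Subtype.val Subtype.property
  obtain ⟨p, φ, hφ, hp⟩ := SeqCompactSpace.tendsto_subseq x
  exact hx ⟨φ, hφ⟩ p hp

end PiBase

section Semitopological

variable {S : Type*} [Group S] [TopologicalSpace S]

/-- The points that cannot be separated from `1` by disjoint open sets. -/
def nonHausdorffCore (S : Type*) [Group S] [TopologicalSpace S] : Set S :=
  {h | ∀ O : Set S, IsOpen O → 1 ∈ O → h ∈ closure O}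

lemma mul_mem_closure_of_mem_nonHausdorffCore
    (hl : ∀ a : S, Continuous fun b => a * b) (hr : ∀ a : S, Continuous fun b : S => b * a)
    {h x : S} (hh : h ∈ nonHausdorffCore S) {O : Set S} (hO : IsOpen O) (hx : x ∈ closure O) :
    h * x ∈ closure O := by
  have key : ∀ u ∈ O, h * u ∈ closure O := by
    intro u hu
    rw [mem_closure_iff]
    intro V hV hV'
    have h1 := hh _ (hO.preimage (hr u)) (by simpa using hu)
    obtain ⟨z, hz1, hz2⟩ := mem_closure_iff.1 h1 _ (hV.preimage (hr u)) hV'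
    exact ⟨z * u, hz1, hz2⟩
  have := map_mem_closure (hl h) hx key
  rwa [closure_closure] at this

lemma nonHausdorffCore_subset_interior_closure
    (hl : ∀ a : S, Continuous fun b => a * b) (hr : ∀ a : S, Continuous fun b : S => b * a)
    {O : Set S} (hO : IsOpen O) (h1 : 1 ∈ O) :
    nonHausdorffCore S ⊆ interior (closure O) := by
  intro h hh
  rw [mem_interior]
  refine ⟨(fun b => h⁻¹ * b) ⁻¹' O, ?_, hO.preimage (hl _), by simpa using h1⟩
  intro z hz
  have := mul_mem_closure_of_mem_nonHausdorffCore hl hr hh hO (subset_closure hz)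
  simpa using this

/-- In a group with separately continuous multiplication and continuous inversion, the points
that cannot be separated from `1` form a subgroup. -/
def nonHausdorffSubgroup
    (hl : ∀ a : S, Continuous fun b => a * b) (hr : ∀ a : S, Continuous fun b : S => b * a)
    (hinv : Continuous fun a : S => a⁻¹) : Subgroup S where
  carrier := nonHausdorffCore S
  one_mem' := fun _ _ h1 => subset_closure h1
  mul_mem' := fun ha hb O hO h1 =>
    mul_mem_closure_of_mem_nonHausdorffCore hl hr ha hO (hb O hO h1)
  inv_mem' := by
    intro h hh O hO h1
    have := map_mem_closure hinv (hh _ (hO.preimage hinv) (by simpa using h1)) (t := O)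
      (fun _ hz => hz)
    exact this

end Semitopological

section Relative

variable {G : Type*} [Group G]

/-- The pairs lying in a common left coset of `L`. -/
def cosetRel (L : Subgroup G) : Set (G × G) := {p | p.1⁻¹ * p.2 ∈ L}

/-- The group `L`, to be equipped with the quotient topology under `(x, y) ↦ x⁻¹ * y`. -/
def SigmaGroup (L : Subgroup G) : Type _ := L

instance (L : Subgroup G) : Group (SigmaGroup L) := inferInstanceAs (Group L)

/-- The map `(x, y) ↦ x⁻¹ * y` from pairs in a common left coset of `L` to `L`. -/
def cosetDiff (L : Subgroup G) (p : cosetRel L) : SigmaGroup L := (⟨p.1.1⁻¹ * p.1.2, p.2⟩ : L)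

/-- The inclusion of `L` into the ambient group. -/
def SigmaGroup.incl {L : Subgroup G} : SigmaGroup L →* G := L.subtype

lemma SigmaGroup.incl_injective {L : Subgroup G} :
    Function.Injective (SigmaGroup.incl : SigmaGroup L → G) := Subtype.val_injective

lemma SigmaGroup.incl_mem {L : Subgroup G} (a : SigmaGroup L) : a.incl ∈ L := Subtype.property _

@[simp] lemma incl_cosetDiff {L : Subgroup G} (p : cosetRel L) :
    (cosetDiff L p).incl = p.1.1⁻¹ * p.1.2 := rfl

/-- Conjugation by an element of the ambient group. -/
def SigmaGroup.conj {L : Subgroup G} (hL : L.Normal) (g : G) (a : SigmaGroup L) : SigmaGroup L :=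
  (⟨g * a.incl * g⁻¹, hL.conj_mem _ a.incl_mem g⟩ : L)

lemma SigmaGroup.incl_conj {L : Subgroup G} (hL : L.Normal) (g : G) (a : SigmaGroup L) :
    (a.conj hL g).incl = g * a.incl * g⁻¹ := rfl

variable [TopologicalSpace G]

instance (L : Subgroup G) : TopologicalSpace (SigmaGroup L) :=
  TopologicalSpace.coinduced (cosetDiff L) inferInstance

lemma continuous_cosetDiff (L : Subgroup G) : Continuous (cosetDiff L) := continuous_coinduced_rng

/-- A self-map of `SigmaGroup L` covered by a continuous self-map of pairs is continuous. -/
lemma SigmaGroup.continuous_of_lift {L : Subgroup G} (f : SigmaGroup L → SigmaGroup L)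
    (F : G × G → G × G) (hF : Continuous F)
    (h : ∀ p : cosetRel L, (F p.1).1⁻¹ * (F p.1).2 = (f (cosetDiff L p)).incl) : Continuous f := by
  rw [continuous_coinduced_dom]
  have hm : ∀ p : cosetRel L, F p.1 ∈ cosetRel L := fun p => by
    change _ ∈ L
    rw [h p]
    exact SigmaGroup.incl_mem _
  have : f ∘ cosetDiff L = cosetDiff L ∘ fun p => ⟨F p.1, hm p⟩ := by
    funext p
    exact SigmaGroup.incl_injective (h p).symm
  rw [this]
  exact (continuous_cosetDiff L).comp ((hF.comp continuous_subtype_val).subtype_mk _)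

lemma SigmaGroup.continuous_mul_left {L : Subgroup G}
    (hright : ∀ h : G, Continuous fun g : G => g * h) (a : SigmaGroup L) :
    Continuous fun b => a * b :=
  continuous_of_lift _ (fun p => (p.1 * a.incl⁻¹, p.2))
    (((hright _).comp continuous_fst).prodMk continuous_snd)
    fun p => by simp [mul_assoc]

lemma SigmaGroup.continuous_mul_right {L : Subgroup G}
    (hright : ∀ h : G, Continuous fun g : G => g * h) (a : SigmaGroup L) :
    Continuous fun b => b * a :=
  continuous_of_lift _ (fun p => (p.1, p.2 * a.incl))
    (continuous_fst.prodMk ((hright _).comp continuous_snd))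
    fun p => by simp [mul_assoc]

lemma SigmaGroup.continuous_inv {L : Subgroup G} : Continuous fun b : SigmaGroup L => b⁻¹ :=
  continuous_of_lift _ Prod.swap continuous_swap fun p => by simp

lemma SigmaGroup.continuous_conj {L : Subgroup G} (hL : L.Normal)
    (hright : ∀ h : G, Continuous fun g : G => g * h) (g : G) :
    Continuous fun b : SigmaGroup L => b.conj hL g :=
  continuous_of_lift _ (fun p => (p.1 * g⁻¹, p.2 * g⁻¹))
    (((hright _).comp continuous_fst).prodMk ((hright _).comp continuous_snd))
    fun p => by simp [mul_assoc, incl_conj]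

/-- If `x` and `y` are the translates of points of an open set of pairs, then the translating
element can be taken in the topological center. -/
lemma exists_mem_center_translate (hright : ∀ h : G, Continuous fun g : G => g * h)
    (hadm : Dense {g : G | Continuous fun h : G => g * h}) {O : Set (G × G)} (hO : IsOpen O)
    {g x y : G} (h : (g * x, g * y) ∈ O) :
    ∃ l : G, (Continuous fun h : G => l * h) ∧ (l * x, l * y) ∈ O := by
  obtain ⟨l, hl, hl'⟩ := hadm.exists_mem_open
    (hO.preimage ((hright x).prodMk (hright y))) ⟨g, h⟩
  exact ⟨l, hl, hl'⟩

lemma isOpenMap_cosetDiff (L : Subgroup G) (hright : ∀ h : G, Continuous fun g : G => g * h)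
    (hadm : Dense {g : G | Continuous fun h : G => g * h}) : IsOpenMap (cosetDiff L) := by
  rintro _ ⟨O, hO, rfl⟩
  rw [isOpen_coinduced, isOpen_iff_forall_mem_open]
  rintro ⟨⟨x, y⟩, hxy⟩ ⟨⟨⟨x', y'⟩, hxy'⟩, hmem, heq⟩
  have heq' : x'⁻¹ * y' = x⁻¹ * y := congrArg SigmaGroup.incl heq
  have hO' : ((x' * x⁻¹) * x, (x' * x⁻¹) * y) ∈ O := by
    have : x' * x⁻¹ * y = y' := by rw [mul_assoc, ← heq']; simp
    rw [this]
    simpa using hmem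
  obtain ⟨l, hl, hlO⟩ := exists_mem_center_translate hright hadm hO hO'
  refine ⟨(fun p : cosetRel L => (l * p.1.1, l * p.1.2)) ⁻¹' O, ?_, ?_, hlO⟩
  · rintro ⟨⟨a, b⟩, hab⟩ habO
    refine ⟨⟨(l * a, l * b), ?_⟩, habO, SigmaGroup.incl_injective ?_⟩
    · change (l * a)⁻¹ * (l * b) ∈ L
      have : a⁻¹ * b ∈ L := hab
      simpa [mul_assoc] using this
    · simp [mul_assoc]
  · exact hO.preimage ((hl.comp (continuous_fst.comp continuous_subtype_val)).prodMk
      (hl.comp (continuous_snd.comp continuous_subtype_val)))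

/-- A normal subgroup whose coset space is Hausdorff and metrizable, phrased through its coset
relation. -/
structure IsMetrizableNormal (L : Subgroup G) : Prop where
  normal : L.Normal
  isClosed : IsClosed (cosetRel L)
  isGδ : IsGδ (cosetRel L)

/-- The neighborhoods of `1` in `SigmaGroup L` given by a local π-base. -/
lemma exists_sigma_basis (L : Subgroup G) (hright : ∀ h : G, Continuous fun g : G => g * h)
    (hadm : Dense {g : G | Continuous fun h : G => g * h})
    (hπ : HasCountableLocalPiBase (1 : G)) :
    ∃ O : ℕ → Set (SigmaGroup L), (∀ n, IsOpen (O n)) ∧ (∀ n, 1 ∈ O n) ∧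
      ∀ W ∈ 𝓝 (1 : G), ∃ n, ∀ a ∈ O n, ∃ u ∈ W, u * a.incl ∈ W := by
  obtain ⟨U, hU, hne, hW⟩ := hπ
  refine ⟨fun n => cosetDiff L '' (Subtype.val ⁻¹' (U n ×ˢ U n)), fun n => ?_, fun n => ?_,
    fun W hWn => ?_⟩
  · exact isOpenMap_cosetDiff L hright hadm _
      (((hU n).prod (hU n)).preimage continuous_subtype_val)
  · obtain ⟨u, hu⟩ := hne n
    exact ⟨⟨(u, u), by simp [cosetRel, L.one_mem]⟩, ⟨hu, hu⟩,
      SigmaGroup.incl_injective (by simp)⟩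
  · obtain ⟨n, hn⟩ := hW W hWn
    refine ⟨n, ?_⟩
    rintro _ ⟨⟨⟨x, y⟩, hxy⟩, ⟨hx, hy⟩, rfl⟩
    exact ⟨x, hn hx, by simpa using hn hy⟩

/-- The sets in `exists_sigma_basis` form a neighborhood basis of `1`. -/
lemma exists_subset_of_sigma_basis {L : Subgroup G} {O : ℕ → Set (SigmaGroup L)}
    (hO : ∀ W ∈ 𝓝 (1 : G), ∃ n, ∀ a ∈ O n, ∃ u ∈ W, u * a.incl ∈ W)
    {V : Set (SigmaGroup L)} (hV : IsOpen V) (h1 : 1 ∈ V) : ∃ n, O n ⊆ V := by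
  have hV' := hV.preimage (continuous_cosetDiff L)
  obtain ⟨P, hP, hPV⟩ := isOpen_induced_iff.1 hV'
  have h11 : ((1 : G), (1 : G)) ∈ P := by
    have hmem : ((1 : G), (1 : G)) ∈ cosetRel L := by simp [cosetRel, L.one_mem]
    have : (⟨(1, 1), hmem⟩ : cosetRel L) ∈ cosetDiff L ⁻¹' V := by
      have : cosetDiff L ⟨(1, 1), hmem⟩ = 1 := SigmaGroup.incl_injective (by simp)
      rwa [mem_preimage, this]
    rw [← hPV] at this
    exact this
  obtain ⟨W, hW, hWP⟩ : ∃ W ∈ 𝓝 (1 : G), W ×ˢ W ⊆ P := by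
    obtain ⟨A, hA, B, hB, hAB⟩ := mem_nhds_prod_iff.1 (hP.mem_nhds h11)
    exact ⟨A ∩ B, inter_mem hA hB, (prod_mono inter_subset_left inter_subset_right).trans hAB⟩
  obtain ⟨n, hn⟩ := hO W hW
  refine ⟨n, fun a ha => ?_⟩
  obtain ⟨u, hu, hua⟩ := hn a ha
  have hmem : (u, u * a.incl) ∈ cosetRel L := by simpa [cosetRel] using a.incl_mem
  have : (⟨(u, u * a.incl), hmem⟩ : cosetRel L) ∈ cosetDiff L ⁻¹' V := by
    rw [← hPV]
    exact hWP ⟨hu, hua⟩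
  have heq : cosetDiff L ⟨(u, u * a.incl), hmem⟩ = a := SigmaGroup.incl_injective (by simp)
  rwa [mem_preimage, heq] at this

/-- The subgroup of `L` consisting of the points inseparable from `1` in `SigmaGroup L`. -/
def derivedNormal (L : Subgroup G) (hright : ∀ h : G, Continuous fun g : G => g * h) :
    Subgroup G :=
  (nonHausdorffSubgroup (S := SigmaGroup L) (SigmaGroup.continuous_mul_left hright)
    (SigmaGroup.continuous_mul_right hright) SigmaGroup.continuous_inv).map SigmaGroup.incl

lemma mem_derivedNormal {L : Subgroup G} {hright : ∀ h : G, Continuous fun g : G => g * h}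
    (a : SigmaGroup L) :
    a.incl ∈ derivedNormal L hright ↔ a ∈ nonHausdorffCore (SigmaGroup L) :=
  ⟨fun ⟨_, hb, hab⟩ => SigmaGroup.incl_injective hab ▸ hb, fun ha => ⟨a, ha, rfl⟩⟩

lemma derivedNormal_le (L : Subgroup G) (hright : ∀ h : G, Continuous fun g : G => g * h) :
    derivedNormal L hright ≤ L := by
  rintro _ ⟨a, -, rfl⟩
  exact a.incl_mem

lemma cosetRel_derivedNormal (L : Subgroup G) (hright : ∀ h : G, Continuous fun g : G => g * h) :
    cosetRel (derivedNormal L hright) =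
      Subtype.val '' (cosetDiff L ⁻¹' nonHausdorffCore (SigmaGroup L)) := by
  ext p
  constructor
  · intro hp
    have hpL : p ∈ cosetRel L := derivedNormal_le L hright hp
    exact ⟨⟨p, hpL⟩, (mem_derivedNormal (hright := hright) (cosetDiff L ⟨p, hpL⟩)).1 hp, rfl⟩
  · rintro ⟨q, hq, rfl⟩
    exact (mem_derivedNormal (hright := hright) (cosetDiff L q)).2 hq

lemma IsMetrizableNormal.derivedNormal {L : Subgroup G} (hL : IsMetrizableNormal L)
    (hright : ∀ h : G, Continuous fun g : G => g * h)
    (hadm : Dense {g : G | Continuous fun h : G => g * h})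
    (hπ : HasCountableLocalPiBase (1 : G)) : IsMetrizableNormal (derivedNormal L hright) := by
  refine ⟨⟨?_⟩, ?_, ?_⟩
  · rintro _ ⟨a, ha, rfl⟩ g
    rw [← a.incl_conj hL.normal, mem_derivedNormal]
    intro O hO h1
    refine map_mem_closure (SigmaGroup.continuous_conj hL.normal hright g)
      (ha _ (hO.preimage (SigmaGroup.continuous_conj hL.normal hright g)) ?_) fun _ hz => hz
    have : (1 : SigmaGroup L).conj hL.normal g = 1 :=
      SigmaGroup.incl_injective (by simp [SigmaGroup.incl_conj])
    simpa [this] using h1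
  · rw [cosetRel_derivedNormal]
    refine hL.isClosed.isClosedEmbedding_subtypeVal.isClosedMap _
      (IsClosed.preimage (continuous_cosetDiff L) ?_)
    have : nonHausdorffCore (SigmaGroup L) =
        ⋂ (O : Set (SigmaGroup L)) (_ : IsOpen O) (_ : 1 ∈ O), closure O := by
      ext; simp [nonHausdorffCore]
    rw [this]
    exact isClosed_iInter fun _ => isClosed_iInter fun _ => isClosed_iInter fun _ =>
      isClosed_closure
  · obtain ⟨O, hO, h1, hbasis⟩ := exists_sigma_basis L hright hadm hπ
    have hcore : nonHausdorffCore (SigmaGroup L) = ⋂ n, interior (closure (O n)) := by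
      refine subset_antisymm (subset_iInter fun n => nonHausdorffCore_subset_interior_closure
        (SigmaGroup.continuous_mul_left hright) (SigmaGroup.continuous_mul_right hright)
        (hO n) (h1 n)) fun a ha V hV hV1 => ?_
      obtain ⟨n, hn⟩ := exists_subset_of_sigma_basis hbasis hV hV1
      exact closure_mono hn (interior_subset (mem_iInter.1 ha n))
    have hopen : ∀ n, ∃ P : Set (G × G), IsOpen P ∧
        Subtype.val ⁻¹' P = cosetDiff L ⁻¹' interior (closure (O n)) := fun n =>
      isOpen_induced_iff.1 (isOpen_interior.preimage (continuous_cosetDiff L))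
    choose P hP hPO using hopen
    have : cosetRel (_root_.derivedNormal L hright) = cosetRel L ∩ ⋂ n, P n := by
      rw [cosetRel_derivedNormal, hcore, preimage_iInter]
      simp_rw [← hPO]
      rw [← preimage_iInter, Subtype.image_preimage_coe]
    rw [this]
    exact hL.isGδ.inter (IsGδ.iInter_of_isOpen hP)

/-- The only subgroup that equals its derived normal subgroup is the trivial one. -/
lemma eq_bot_of_le_derivedNormal [CompactSpace G] [T2Space G] {L : Subgroup G}
    (hL : IsMetrizableNormal L) (hright : ∀ h : G, Continuous fun g : G => g * h)
    (hadm : Dense {g : G | Continuous fun h : G => g * h})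
    (hπ : HasCountableLocalPiBase (1 : G)) (hle : L ≤ derivedNormal L hright) : L = ⊥ := by
  obtain ⟨O, hO, h1, hbasis⟩ := exists_sigma_basis L hright hadm hπ
  have : CompactSpace (cosetRel L) := isCompact_iff_compactSpace.1 hL.isClosed.isCompact
  have hcore : ∀ a, a ∈ nonHausdorffCore (SigmaGroup L) := fun a =>
    (mem_derivedNormal (hright := hright) a).1 (hle a.incl_mem)
  have hdense : ∀ n, Dense (cosetDiff L ⁻¹' O n) := by
    refine fun n => Dense.preimage ?_ (isOpenMap_cosetDiff L hright hadm)
    intro a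
    simpa using mul_mem_closure_of_mem_nonHausdorffCore (SigmaGroup.continuous_mul_left hright)
      (SigmaGroup.continuous_mul_right hright) (hcore a) (hO n) (subset_closure (h1 n))
  have hd := dense_iInter_of_isOpen_nat (fun n => (hO n).preimage (continuous_cosetDiff L)) hdense
  have hdiag : (⋂ n, cosetDiff L ⁻¹' O n) ⊆ {p : cosetRel L | p.1.1 = p.1.2} := by
    intro p hp
    set a := cosetDiff L p with ha
    have hnear : ∀ W ∈ 𝓝 (1 : G), ∃ u ∈ W, u * a.incl ∈ W := fun W hW => by
      obtain ⟨n, hn⟩ := hbasis W hW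
      exact hn a (mem_iInter.1 hp n)
    have ha1 : a.incl = 1 := by
      by_contra hne
      obtain ⟨A, B, hA, hB, haA, h1B, hAB⟩ := t2_separation hne
      obtain ⟨u, ⟨hu1, hu2⟩, hu⟩ := hnear (((fun g => g * a.incl) ⁻¹' A) ∩ B)
        (inter_mem ((hA.preimage (hright _)).mem_nhds (by simpa using haA)) (hB.mem_nhds h1B))
      exact disjoint_left.1 hAB hu1 hu.2
    simpa [ha, inv_mul_eq_one] using ha1
  have hclosed : IsClosed {p : cosetRel L | p.1.1 = p.1.2} :=
    isClosed_eq (continuous_fst.comp continuous_subtype_val)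
      (continuous_snd.comp continuous_subtype_val)
  have hall : ∀ p : cosetRel L, p.1.1 = p.1.2 := fun p =>
    closure_minimal hdiag hclosed (hd p)
  rw [eq_bot_iff]
  intro l hl
  exact (hall ⟨(1, l), by simpa [cosetRel] using hl⟩).symm

lemma IsMetrizableNormal.iInf {ι : Type*} [Countable ι] {L : ι → Subgroup G}
    (hL : ∀ i, IsMetrizableNormal (L i)) : IsMetrizableNormal (⨅ i, L i) := by
  have h : cosetRel (⨅ i, L i) = ⋂ i, cosetRel (L i) := by
    ext; simp [cosetRel, Subgroup.mem_iInf]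
  refine ⟨Subgroup.normal_iInf_normal fun i => (hL i).normal, ?_, ?_⟩
  · rw [h]; exact isClosed_iInter fun i => (hL i).isClosed
  · rw [h]; exact IsGδ.iInter fun i => (hL i).isGδ

lemma IsMetrizableNormal.top : IsMetrizableNormal (⊤ : Subgroup G) := by
  have h : cosetRel (⊤ : Subgroup G) = univ := by ext; simp [cosetRel]
  exact ⟨inferInstance, h ▸ isClosed_univ, h ▸ IsGδ.univ⟩

/-- In a compact group with a countable local π-base at `1`, the intersection of all the
subgroups with metrizable quotient has metrizable quotient. -/
lemma exists_least_isMetrizableNormal [CompactSpace G] [T2Space G]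
    (hright : ∀ h : G, Continuous fun g : G => g * h)
    (hπ : HasCountableLocalPiBase (1 : G)) :
    ∃ L : Subgroup G, IsMetrizableNormal L ∧ ∀ L', IsMetrizableNormal L' → L ≤ L' := by
  obtain ⟨U, hU, hne, hW⟩ := hπ
  choose u hu using hne
  let M := {L : Subgroup G // IsMetrizableNormal L}
  have hstep : ∀ n, ∃ L : M, ∀ y, (u n)⁻¹ * y ∈ L.1 →
      ∃ w ∈ U n, ∀ L' : M, w⁻¹ * y ∈ L'.1 := by
    intro n
    let T : Set G := {y | ∃ w ∈ U n, ∀ L' : M, w⁻¹ * y ∈ L'.1}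
    have hT : IsOpen T := by
      rw [isOpen_iff_forall_mem_open]
      rintro y ⟨w, hw, hy⟩
      refine ⟨(fun g => g * (w⁻¹ * y)⁻¹) ⁻¹' U n, ?_, (hU n).preimage (hright _),
        by simpa using hw⟩
      intro z hz
      refine ⟨_, hz, fun L' => ?_⟩
      simpa [mul_assoc] using hy L'
    have : Nonempty M := ⟨⟨⊤, .top⟩⟩
    have hdir : Directed (· ⊇ ·) fun L : M => {y | (u n)⁻¹ * y ∈ L.1} := by
      intro L₁ L₂
      have h : IsMetrizableNormal (⨅ b : Bool, bif b then L₁.1 else L₂.1) :=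
        .iInf fun b => by cases b <;> simp [L₁.2, L₂.2]
      exact ⟨⟨_, h⟩, fun y hy => Subgroup.mem_iInf.1 hy true,
        fun y hy => Subgroup.mem_iInf.1 hy false⟩
    exact exists_subset_nhds_of_compactSpace hdir
      (fun L => L.2.isClosed.preimage (by fun_prop : Continuous fun y => (u n, y)))
      fun y hy => hT.mem_nhds ⟨u n, hu n, fun L' => mem_iInter.1 hy L'⟩
  choose L hL using hstep
  refine ⟨⨅ n, (L n).1, .iInf fun n => (L n).2, fun L' hL' l hl => ?_⟩
  by_contra hlL
  have hnot : ((1 : G), l) ∉ cosetRel L' := by simpa [cosetRel] using hlL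
  obtain ⟨A, hA, B, hB, hAB⟩ := mem_nhds_prod_iff.1
    (hL'.isClosed.isOpen_compl.mem_nhds hnot)
  obtain ⟨n, hn⟩ := hW (A ∩ (fun g => g * l) ⁻¹' B)
    (inter_mem hA ((hright l).continuousAt.preimage_mem_nhds (by simpa using hB)))
  obtain ⟨w, hw, hwL⟩ := hL n (u n * l) (by simpa using Subgroup.mem_iInf.1 hl n)
  exact hAB (show (w, u n * l) ∈ A ×ˢ B from ⟨(hn hw).1, (hn (hu n)).2⟩) (hwL ⟨L', hL'⟩)

end Relative

/-- A compact Hausdorff space with a `Gδ` diagonal is metrizable. -/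
lemma metrizableSpace_of_isGδ_diagonal {X : Type*} [TopologicalSpace X] [CompactSpace X]
    [T2Space X] (h : IsGδ (diagonal X)) : TopologicalSpace.MetrizableSpace X := by
  obtain ⟨O, hO, hdiag⟩ := isGδ_iff_eq_iInter_nat.1 h
  have hsub : ∀ n, diagonal X ⊆ O n := fun n => hdiag ▸ iInter_subset O n
  choose W hW hdW hWO using fun n =>
    normal_exists_closure_subset isClosed_diagonal (hO n) (hsub n)
  let _ : UniformSpace X := uniformSpaceOfCompactR1
  have hgen : uniformity X = ⨅ n, 𝓟 (W n) := by
    rw [← nhdsSet_diagonal_eq_uniformity]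
    refine le_antisymm (le_iInf fun n => ?_) fun V hV => ?_
    · exact le_principal_iff.2 ((hW n).mem_nhdsSet.2 (hdW n))
    · obtain ⟨V', hV', hdV, hVV⟩ := mem_nhdsSet_iff_exists.1 hV
      have hinter : univ ∩ ⋂ n, closure (W n) ∩ V'ᶜ = ∅ := by
        rw [eq_empty_iff_forall_notMem]
        rintro p ⟨-, hp⟩
        have hp' := mem_iInter.1 hp
        exact (hp' 0).2 (hdV (hdiag ▸ mem_iInter.2 fun n => hWO n (hp' n).1))
      obtain ⟨s, hs⟩ := isCompact_univ.elim_finite_subfamily_closed _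
        (fun n => isClosed_closure.inter hV'.isClosed_compl) hinter
      have hsV : (⋂ i ∈ s, W i) ⊆ V := fun p hp => hVV <| by
        by_contra hpV
        exact hs.subset ⟨mem_univ p, mem_iInter₂.2 fun i hi =>
          ⟨subset_closure (mem_iInter₂.1 hp i hi), hpV⟩⟩
      exact mem_of_superset ((biInter_finset_mem s).2 fun i _ =>
        mem_iInf_of_mem i (mem_principal_self _)) hsV
  have : (uniformity X).IsCountablyGenerated := by
    rw [hgen]; infer_instance
  exact UniformSpace.metrizableSpace

/-- A compact Hausdorff admissible right topological group with a countable local π-base at `1`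
is metrizable. -/
theorem metrizableSpace_of_hasCountableLocalPiBase {G : Type*} [Group G] [TopologicalSpace G]
    [CompactSpace G] [T2Space G] (hright : ∀ h : G, Continuous fun g : G => g * h)
    (hadm : Dense {g : G | Continuous fun h : G => g * h})
    (hπ : HasCountableLocalPiBase (1 : G)) : TopologicalSpace.MetrizableSpace G := by
  obtain ⟨L, hL, hmin⟩ := exists_least_isMetrizableNormal hright hπ
  have hbot := eq_bot_of_le_derivedNormal hL hright hadm hπ
    (hmin _ (hL.derivedNormal hright hadm hπ))
  refine metrizableSpace_of_isGδ_diagonal ?_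
  convert hL.isGδ
  ext p
  simp [hbot, cosetRel, inv_mul_eq_one]

/-- Assuming the continuum hypothesis (`2 ^ ℵ₀ = ℵ₁`), every sequentially compact
CHART group (compact Hausdorff admissible right topological group) is metrizable. -/
theorem metrizable_of_chart_seqCompact_of_CH {G : Type*} [Group G] [TopologicalSpace G]
    [CompactSpace G] [T2Space G] [SeqCompactSpace G]
    (hCH : (2 : Cardinal.{0}) ^ Cardinal.aleph0 = Cardinal.aleph 1)
    (hright : ∀ h : G, Continuous fun g : G => g * h)
    (hadm : Dense {g : G | Continuous fun h : G => g * h}) :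
    TopologicalSpace.MetrizableSpace G := by
  obtain ⟨p, U, hU, hne, hW⟩ := exists_hasCountableLocalPiBase hCH (X := G)
  refine metrizableSpace_of_hasCountableLocalPiBase hright hadm
    ⟨fun n => (fun g => g * p) ⁻¹' U n, fun n => (hU n).preimage (hright p), fun n => ?_,
      fun W h => ?_⟩
  · obtain ⟨u, hu⟩ := hne n
    exact ⟨u * p⁻¹, by simpa using hu⟩
  · obtain ⟨n, hn⟩ := hW ((fun g => g * p⁻¹) ⁻¹' W)
      ((hright p⁻¹).continuousAt.preimage_mem_nhds (by simpa using h))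
    exact ⟨n, fun g hg => by simpa using hn hg⟩
end
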